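/- arXiv:math/0612536 — 2 statements merged into one kernel-verified Lean document; each statement's English description precedes it below -/
import Mathlib

section
/- If v ∈ C¹(Ω), then F(v) equals the (possibly infinite) Lebesgue integral ∫_Ω √(v(x)² + |Dv(x)|²) dx, where Dv is the classical gradient of v. -/
open MeasureTheory
open scoped ENNReal

/-- A family `g = (g₁, …, g_{n+1})` of test vector fields for the weighted area
functional: each `gᵢ` is `C¹` with compact support contained in `Ω`, and
`∑ᵢ gᵢ(x)² ≤ 1` for every `x`. -/
def Admissible (n : ℕ) (Ω : Set (EuclideanSpace ℝ (Fin n)))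
    (g : Fin (n + 1) → EuclideanSpace ℝ (Fin n) → ℝ) : Prop :=
  (∀ i, ContDiff ℝ 1 (g i)) ∧ (∀ i, HasCompactSupport (g i)) ∧
    (∀ i, tsupport (g i) ⊆ Ω) ∧ ∀ x, ∑ i, g i x ^ 2 ≤ 1

/-- `F(v) = ∫_Ω √(v² + |Dv|²)`, defined by duality as a value in `[0, ∞]`. -/
noncomputable def Ffun (n : ℕ) (Ω : Set (EuclideanSpace ℝ (Fin n)))
    (v : EuclideanSpace ℝ (Fin n) → ℝ) : ℝ≥0∞ :=
  ⨆ g : { g // Admissible n Ω g },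
    ENNReal.ofReal (∫ x in Ω, v x * (g.1 (Fin.last n) x +
      ∑ i : Fin n, fderiv ℝ (g.1 i.castSucc) x (EuclideanSpace.single i 1)))

/-- `A(v) = ∫_Ω √(1 + |Dv|²)`, the area functional, defined by duality. -/
noncomputable def Afun (n : ℕ) (Ω : Set (EuclideanSpace ℝ (Fin n)))
    (v : EuclideanSpace ℝ (Fin n) → ℝ) : ℝ≥0∞ :=
  ⨆ g : { g // Admissible n Ω g },
    ENNReal.ofReal (∫ x in Ω, (g.1 (Fin.last n) x +
      v x * ∑ i : Fin n, fderiv ℝ (g.1 i.castSucc) x (EuclideanSpace.single i 1)))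

/-- Test fields for the total variation: `n` components. -/
def AdmissibleT (n : ℕ) (Ω : Set (EuclideanSpace ℝ (Fin n)))
    (g : Fin n → EuclideanSpace ℝ (Fin n) → ℝ) : Prop :=
  (∀ i, ContDiff ℝ 1 (g i)) ∧ (∀ i, HasCompactSupport (g i)) ∧
    (∀ i, tsupport (g i) ⊆ Ω) ∧ ∀ x, ∑ i, g i x ^ 2 ≤ 1

/-- `T(v) = ∫_Ω |Dv|`, the total variation, defined by duality. -/
noncomputable def Tfun (n : ℕ) (Ω : Set (EuclideanSpace ℝ (Fin n)))
    (v : EuclideanSpace ℝ (Fin n) → ℝ) : ℝ≥0∞ :=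
  ⨆ g : { g // AdmissibleT n Ω g },
    ENNReal.ofReal (∫ x in Ω,
      v x * ∑ i : Fin n, fderiv ℝ (g.1 i) x (EuclideanSpace.single i 1))

section Auxiliary

open Set Filter Topology
open scoped Manifold

variable {n : ℕ} {Ω K : Set (EuclideanSpace ℝ (Fin n))} {v : EuclideanSpace ℝ (Fin n) → ℝ}

/-- The field `(-∂₁v, …, -∂ₙv, v)`, against which integration by parts tests an admissible
family. -/
noncomputable def dualField (v : EuclideanSpace ℝ (Fin n) → ℝ) (x : EuclideanSpace ℝ (Fin n)) :
    EuclideanSpace ℝ (Fin (n + 1)) :=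
  WithLp.toLp 2 (Fin.snoc (α := fun _ => ℝ)
    (fun i => -fderiv ℝ v x (EuclideanSpace.single i 1)) (v x))

@[simp] lemma dualField_castSucc (x : EuclideanSpace ℝ (Fin n)) (i : Fin n) :
    dualField v x i.castSucc = -fderiv ℝ v x (EuclideanSpace.single i 1) := by
  simp [dualField]

@[simp] lemma dualField_last (x : EuclideanSpace ℝ (Fin n)) :
    dualField v x (Fin.last n) = v x := by
  simp [dualField]

lemma norm_sq_eq_sum_apply_single (L : EuclideanSpace ℝ (Fin n) →L[ℝ] ℝ) :
    ‖L‖ ^ 2 = ∑ i, L (EuclideanSpace.single i 1) ^ 2 := by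
  obtain ⟨u, rfl⟩ := (InnerProductSpace.toDual ℝ (EuclideanSpace ℝ (Fin n))).surjective L
  rw [LinearIsometryEquiv.norm_map, EuclideanSpace.real_norm_sq_eq]
  simp [InnerProductSpace.toDual_apply_apply, EuclideanSpace.inner_single_right]

lemma norm_dualField (x : EuclideanSpace ℝ (Fin n)) :
    ‖dualField v x‖ = √(v x ^ 2 + ‖fderiv ℝ v x‖ ^ 2) := by
  rw [norm_sq_eq_sum_apply_single, EuclideanSpace.norm_eq, Fin.sum_univ_castSucc]
  simp [add_comm]

lemma continuousOn_fderiv_apply (hΩo : IsOpen Ω) (hv : ContDiffOn ℝ 1 v Ω)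
    (e : EuclideanSpace ℝ (Fin n)) : ContinuousOn (fun x => fderiv ℝ v x e) Ω :=
  (hv.continuousOn_fderiv_of_isOpen hΩo le_rfl).clm_apply continuousOn_const

lemma continuousOn_dualField (hΩo : IsOpen Ω) (hv : ContDiffOn ℝ 1 v Ω) :
    ContinuousOn (dualField v) Ω := by
  refine (PiLp.continuous_toLp 2 _).comp_continuousOn (continuousOn_pi.2 fun i => ?_)
  refine Fin.lastCases ?_ (fun i => ?_) i
  · simpa using hv.continuousOn
  · simp only [Fin.snoc_castSucc]
    exact (continuousOn_fderiv_apply hΩo hv _).neg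

lemma integrable_mul_of_tsupport_subset (hΩo : IsOpen Ω) {f g : EuclideanSpace ℝ (Fin n) → ℝ}
    (hf : ContinuousOn f Ω) (hg : Continuous g) (hgc : HasCompactSupport g)
    (hgs : tsupport g ⊆ Ω) : Integrable fun x => f x * g x := by
  have hs : tsupport (fun x => f x * g x) ⊆ tsupport g := tsupport_mul_subset_right
  exact ((hf.mul hg.continuousOn).continuous_of_tsupport_subset hΩo
    (hs.trans hgs)).integrable_of_hasCompactSupport hgc.mul_left

lemma setIntegral_mul_fderiv (hΩo : IsOpen Ω) (hv : ContDiffOn ℝ 1 v Ω)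
    {g : EuclideanSpace ℝ (Fin n) → ℝ} (hg : ContDiff ℝ 1 g) (hgc : HasCompactSupport g)
    (hgs : tsupport g ⊆ Ω) (e : EuclideanSpace ℝ (Fin n)) :
    ∫ x in Ω, v x * fderiv ℝ g x e = ∫ x in Ω, -fderiv ℝ v x e * g x := by
  have hsub := (tsupport_fderiv_apply_subset ℝ (f := g) e)
  have key := integral_bilinear_hasLineDerivAt_right_eq_neg_left_of_integrable
    (B := ContinuousLinearMap.mul ℝ ℝ) (μ := volume) (v := e) (f := v) (g := g)
    (f' := fun x => fderiv ℝ v x e) (g' := fun x => fderiv ℝ g x e)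
    (integrable_mul_of_tsupport_subset hΩo (continuousOn_fderiv_apply hΩo hv e)
      hg.continuous hgc hgs)
    (integrable_mul_of_tsupport_subset hΩo hv.continuousOn
      ((hg.continuous_fderiv one_ne_zero).clm_apply continuous_const)
      (hgc.fderiv_apply ℝ e) (hsub.trans hgs))
    (integrable_mul_of_tsupport_subset hΩo hv.continuousOn hg.continuous hgc hgs)
    (fun x hx => ((hv.contDiffAt (hΩo.mem_nhds (hgs hx))).differentiableAt
      one_ne_zero).hasFDerivAt.hasLineDerivAt e)
    (fun x _ => (hg.differentiable one_ne_zero x).hasFDerivAt.hasLineDerivAt e)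
  simp only [ContinuousLinearMap.mul_apply'] at key
  rw [setIntegral_eq_integral_of_forall_compl_eq_zero,
    setIntegral_eq_integral_of_forall_compl_eq_zero, key, ← integral_neg]
  · simp
  · intro x hx
    rw [image_eq_zero_of_notMem_tsupport fun h => hx (hgs h), mul_zero]
  · intro x hx
    rw [image_eq_zero_of_notMem_tsupport (f := fun x => fderiv ℝ g x e)
      fun h => hx (hgs (hsub h)), mul_zero]

lemma Admissible.integrable_dualField_mul {g : Fin (n + 1) → EuclideanSpace ℝ (Fin n) → ℝ}
    (hg : Admissible n Ω g) (hΩo : IsOpen Ω) (hv : ContDiffOn ℝ 1 v Ω) (i : Fin (n + 1)) :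
    Integrable fun x => dualField v x i * g i x :=
  integrable_mul_of_tsupport_subset hΩo
    ((EuclideanSpace.proj i).continuous.comp_continuousOn (continuousOn_dualField hΩo hv))
    (hg.1 i).continuous (hg.2.1 i) (hg.2.2.1 i)

lemma Admissible.setIntegral_eq {g : Fin (n + 1) → EuclideanSpace ℝ (Fin n) → ℝ}
    (hg : Admissible n Ω g) (hΩo : IsOpen Ω) (hv : ContDiffOn ℝ 1 v Ω) :
    ∫ x in Ω, v x * (g (Fin.last n) x +
      ∑ i : Fin n, fderiv ℝ (g i.castSucc) x (EuclideanSpace.single i 1)) =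
    ∫ x in Ω, ∑ i, dualField v x i * g i x := by
  have hint := fun i => (hg.integrable_dualField_mul hΩo hv i).integrableOn (s := Ω)
  have hint' : ∀ i : Fin n, IntegrableOn
      (fun x => v x * fderiv ℝ (g i.castSucc) x (EuclideanSpace.single i 1)) Ω := fun i =>
    (integrable_mul_of_tsupport_subset hΩo hv.continuousOn
      (((hg.1 _).continuous_fderiv one_ne_zero).clm_apply continuous_const)
      ((hg.2.1 _).fderiv_apply ℝ _)
      ((tsupport_fderiv_apply_subset ℝ _).trans (hg.2.2.1 _))).integrableOn
  rw [integral_finsetSum _ fun i _ => hint i, Fin.sum_univ_castSucc]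
  simp only [mul_add, Finset.mul_sum, dualField_castSucc]
  have hlast := hint (Fin.last n)
  simp only [dualField_last] at hlast ⊢
  rw [integral_add hlast (integrable_finsetSum _ fun i _ => hint' i),
    integral_finsetSum _ fun i _ => hint' i, add_comm]
  congr 1
  exact Finset.sum_congr rfl fun i _ =>
    setIntegral_mul_fderiv hΩo hv (hg.1 _) (hg.2.1 _) (hg.2.2.1 _) _

lemma abs_sum_mul_le_norm (w : EuclideanSpace ℝ (Fin n)) {a : Fin n → ℝ}
    (ha : ∑ i, a i ^ 2 ≤ 1) : |∑ i, w i * a i| ≤ ‖w‖ := by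
  refine Real.abs_le_sqrt ((Finset.sum_mul_sq_le_sq_mul_sq _ _ _).trans ?_) |>.trans_eq
    (EuclideanSpace.norm_eq w).symm
  simp only [Real.norm_eq_abs, sq_abs]
  exact mul_le_of_le_one_right (Finset.sum_nonneg fun i _ => sq_nonneg _) ha

lemma Ffun_le (hΩo : IsOpen Ω) (hv : ContDiffOn ℝ 1 v Ω) :
    Ffun n Ω v ≤ ∫⁻ x in Ω, ENNReal.ofReal ‖dualField v x‖ := by
  refine iSup_le fun ⟨g, hg⟩ => ?_
  rw [hg.setIntegral_eq hΩo hv]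
  refine (Real.ofReal_le_enorm _).trans ((enorm_integral_le_lintegral_enorm _).trans ?_)
  refine lintegral_mono fun x => ?_
  rw [Real.enorm_eq_ofReal_abs]
  exact ENNReal.ofReal_le_ofReal (abs_sum_mul_le_norm _ (hg.2.2.2 x))

/-- A continuous field `w` on `Ω` is almost normed, near any compact set, by a smooth field with
values in the unit ball. -/
lemma exists_contDiff_norm_le_one_inner_ge (hΩo : IsOpen Ω) (hK : IsClosed K) (hKΩ : K ⊆ Ω)
    {m : ℕ} {w : EuclideanSpace ℝ (Fin n) → EuclideanSpace ℝ (Fin m)} (hw : ContinuousOn w Ω)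
    {ε : ℝ} (hε : 0 < ε) :
    ∃ G : EuclideanSpace ℝ (Fin n) → EuclideanSpace ℝ (Fin m), ContDiff ℝ 1 G ∧
      (∀ x, ‖G x‖ ≤ 1) ∧ ∀ x ∈ K, ‖w x‖ - ε ≤ inner ℝ (w x) (G x) := by
  let t : EuclideanSpace ℝ (Fin n) → Set (EuclideanSpace ℝ (Fin m)) := fun x =>
    {z | ‖z‖ ≤ 1 ∧ (x ∈ K → ‖w x‖ - ε ≤ inner ℝ (w x) z)}
  have ht : ∀ x, Convex ℝ (t x) := by
    intro x
    have h1 : Convex ℝ {z : EuclideanSpace ℝ (Fin m) | ‖z‖ ≤ 1} := by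
      have h0 : {z : EuclideanSpace ℝ (Fin m) | ‖z‖ ≤ 1} = Metric.closedBall 0 1 := by
        ext z
        simp
      rw [h0]
      exact convex_closedBall 0 1
    by_cases hx : x ∈ K
    · have h2 : t x = {z | ‖z‖ ≤ 1} ∩ {z | ‖w x‖ - ε ≤ inner ℝ (w x) z} := by
        ext z
        simp [t, hx]
      rw [h2]
      exact h1.inter (convex_halfSpace_ge (innerSL ℝ (w x)).isLinear (‖w x‖ - ε))
    · simpa [t, hx] using h1
  have hloc : ∀ x, ∃ c, ∀ᶠ y in 𝓝 x, c ∈ t y := by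
    intro x
    by_cases hx : x ∈ K
    · refine ⟨‖w x‖⁻¹ • w x, ?_⟩
      have hwx : ContinuousAt w x := hw.continuousAt (hΩo.mem_nhds (hKΩ hx))
      have hcont : ContinuousAt
          (fun y => inner ℝ (w y) (‖w x‖⁻¹ • w x) - ‖w y‖) x :=
        (hwx.inner continuousAt_const).sub hwx.norm
      have hval : -ε < inner ℝ (w x) (‖w x‖⁻¹ • w x) - ‖w x‖ := by
        rw [real_inner_smul_right, real_inner_self_eq_norm_sq]
        rcases eq_or_ne ‖w x‖ 0 with h | h
        · simp [h, hε]
        · field_simp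
          simp [hε]
      filter_upwards [hcont.eventually (lt_mem_nhds hval)] with y hy
      refine ⟨?_, fun _ => by linarith⟩
      rw [norm_smul, norm_inv, norm_norm]
      exact inv_mul_le_one
    · refine ⟨0, ?_⟩
      filter_upwards [hK.isOpen_compl.mem_nhds hx] with y hy
      exact ⟨by simp, fun h => absurd h hy⟩
  obtain ⟨G, hG⟩ := exists_contMDiffMap_forall_mem_convex_of_local_const
    𝓘(ℝ, EuclideanSpace ℝ (Fin n)) (n := 1) ht hloc
  exact ⟨G, G.contMDiff.contDiff, fun x => (hG x).1, fun x => (hG x).2⟩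

lemma exists_admissible_ge (hΩo : IsOpen Ω) (hK : IsCompact K) (hKΩ : K ⊆ Ω)
    (hv : ContDiffOn ℝ 1 v Ω) {ε : ℝ} (hε : 0 < ε) :
    ∃ g, Admissible n Ω g ∧
      ∀ x, K.indicator (fun x => ‖dualField v x‖) x ≤ ∑ i, dualField v x i * g i x + ε := by
  obtain ⟨L, hL, hKL, hLΩ⟩ := exists_compact_between hK hΩo hKΩ
  obtain ⟨χ, hχ1, hχ0, hχ⟩ := exists_contMDiffMap_one_nhds_of_subset_interior
    𝓘(ℝ, EuclideanSpace ℝ (Fin n)) (n := 1) hK.isClosed hKL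
  obtain ⟨G, hG, hG1, hGw⟩ := exists_contDiff_norm_le_one_inner_ge hΩo hL.isClosed hLΩ
    (continuousOn_dualField hΩo hv) hε
  have hsupp : ∀ i, tsupport (fun x => χ x * G x i) ⊆ L := fun i =>
    closure_minimal (fun x hx => by
      by_contra h
      exact hx (by simp [hχ0 x h])) hL.isClosed
  refine ⟨fun i x => χ x * G x i, ⟨fun i => χ.contMDiff.contDiff.mul (contDiff_euclidean.1 hG i),
    fun i => hL.of_isClosed_subset (isClosed_tsupport _) (hsupp i),
    fun i => (hsupp i).trans hLΩ, fun x => ?_⟩, fun x => ?_⟩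
  · have hGx : ∑ i, G x i ^ 2 ≤ 1 := by
      rw [← EuclideanSpace.real_norm_sq_eq]
      exact pow_le_one₀ (norm_nonneg _) (hG1 x)
    simp only [mul_pow, ← Finset.mul_sum]
    exact mul_le_one₀ (pow_le_one₀ (hχ x).1 (hχ x).2)
      (Finset.sum_nonneg fun i _ => sq_nonneg _) hGx
  · have hsum : ∑ i, dualField v x i * (χ x * G x i) = χ x * inner ℝ (dualField v x) (G x) := by
      rw [PiLp.inner_apply, Finset.mul_sum]
      refine Finset.sum_congr rfl fun i _ => ?_
      simp only [RCLike.inner_apply, conj_trivial]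
      ring
    rw [hsum]
    have hχx := hχ x
    by_cases hxL : x ∈ L
    · have hind : K.indicator (fun x => ‖dualField v x‖) x ≤ χ x * ‖dualField v x‖ := by
        by_cases hxK : x ∈ K
        · simp [hxK, hχ1.self_of_nhdsSet x hxK]
        · simpa [hxK] using mul_nonneg hχx.1 (norm_nonneg _)
      nlinarith [mul_le_mul_of_nonneg_left (hGw x hxL) hχx.1,
        mul_le_mul_of_nonneg_right hχx.2 hε.le]
    · have hxK : x ∉ K := fun h => hxL (interior_subset (hKL h))
      simp [hxK, hχ0 x hxL, hε.le]

lemma le_Ffun (hΩo : IsOpen Ω) (hΩb : Bornology.IsBounded Ω) (hv : ContDiffOn ℝ 1 v Ω) :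
    ∫⁻ x in Ω, ENNReal.ofReal ‖dualField v x‖ ≤ Ffun n Ω v := by
  obtain ⟨F, hFc, hFΩ, hFU, hFm⟩ := hΩo.exists_iUnion_isClosed
  have hΩ : volume Ω ≠ ∞ := hΩb.measure_lt_top.ne
  conv_lhs => rw [← hFU]
  rw [setLIntegral_iUnion_of_directed _ hFm.directed_le]
  refine iSup_le fun k => ENNReal.le_of_forall_pos_le_add fun δ hδ _ => ?_
  set ε : ℝ := δ / (volume.real Ω + 1)
  have hε : 0 < ε := by positivity
  obtain ⟨g, hg, hgw⟩ := exists_admissible_ge hΩo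
    (Metric.isCompact_of_isClosed_isBounded (hFc k) (hΩb.subset (hFΩ k))) (hFΩ k) hv hε
  have hint : IntegrableOn (fun x => ∑ i, dualField v x i * g i x) Ω :=
    (integrable_finsetSum _ fun i _ => hg.integrable_dualField_mul hΩo hv i).integrableOn
  have hεi : IntegrableOn (fun _ => ε) Ω := integrableOn_const hΩ
  calc ∫⁻ x in F k, ENNReal.ofReal ‖dualField v x‖
      = ∫⁻ x in Ω, (F k).indicator (fun x => ENNReal.ofReal ‖dualField v x‖) x := by
        rw [setLIntegral_indicator (hFc k).measurableSet, inter_eq_left.2 (hFΩ k)]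
    _ ≤ ∫⁻ x in Ω, ENNReal.ofReal (∑ i, dualField v x i * g i x + ε) := by
        refine lintegral_mono fun x => ?_
        refine le_trans (le_of_eq ?_) (ENNReal.ofReal_le_ofReal (hgw x))
        by_cases hx : x ∈ F k <;> simp [hx]
    _ = ENNReal.ofReal (∫ x in Ω, (∑ i, dualField v x i * g i x + ε)) := by
        refine (ofReal_integral_eq_lintegral_ofReal (hint.add hεi) ?_).symm
        exact Eventually.of_forall fun x =>
          (indicator_nonneg (fun _ _ => norm_nonneg _) x).trans (hgw x)
    _ ≤ ENNReal.ofReal (∫ x in Ω, ∑ i, dualField v x i * g i x) + δ := by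
        rw [integral_add hint hεi, setIntegral_const, smul_eq_mul]
        refine ENNReal.ofReal_add_le.trans (add_le_add_right ?_ _)
        refine ENNReal.ofReal_le_of_le_toReal ?_
        simp only [ε, ENNReal.coe_toReal]
        rw [← mul_div_assoc, div_le_iff₀ (by positivity)]
        nlinarith [δ.coe_nonneg]
    _ ≤ Ffun n Ω v + δ := by
        refine add_le_add_left ?_ _
        rw [← hg.setIntegral_eq hΩo hv]
        exact le_iSup (fun g : { g // Admissible n Ω g } =>
          ENNReal.ofReal (∫ x in Ω, v x * (g.1 (Fin.last n) x +
            ∑ i : Fin n, fderiv ℝ (g.1 i.castSucc) x (EuclideanSpace.single i 1)))) ⟨g, hg⟩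

end Auxiliary

/-- if `v ∈ C¹(Ω)`, then `F(v)` equals the (possibly infinite)
Lebesgue integral `∫_Ω √(v² + |Dv|²) dx`, with `Dv` the classical gradient. -/
theorem stmt_3 (n : ℕ) (Ω : Set (EuclideanSpace ℝ (Fin n)))
    (hΩo : IsOpen Ω) (hΩb : Bornology.IsBounded Ω)
    (v : EuclideanSpace ℝ (Fin n) → ℝ) (hv : ContDiffOn ℝ 1 v Ω) :
    Ffun n Ω v =
      ∫⁻ x in Ω, ENNReal.ofReal (Real.sqrt (v x ^ 2 + ‖fderivWithin ℝ v Ω x‖ ^ 2)) := by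
  rw [setLIntegral_congr_fun (g := fun x => ENNReal.ofReal ‖dualField v x‖) hΩo.measurableSet
    fun x hx => by simp only [norm_dualField, fderivWithin_of_isOpen hΩo hx]]
  exact (Ffun_le hΩo hv).antisymm (le_Ffun hΩo hΩb hv)
end

section
/- If v ∈ BV(Ω), then there exists a sequence of smooth functions v_k ∈ C^∞(Ω) such that v_k → v in L¹(Ω) and ∫_Ω √(v_k(x)² + |Dv_k(x)|²) dx → F(v) as k → ∞. -/
open MeasureTheory
open scoped ENNReal

section MeyersSerrin
open Filter Topology Set Metric
open ContinuousLinearMap (lsmul)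
open scoped Manifold ContDiff Convolution

variable {n : ℕ}

local notation "𝔼" => EuclideanSpace ℝ (Fin n)

/-- Mollification of a function by a normalized smooth bump. -/
local notation:67 η:68 "⊛" f:66 => ContDiffBump.normed η volume ⋆[lsmul ℝ ℝ, volume] f

theorem exists_smooth_cutoff {K U : Set 𝔼} (hK : IsCompact K) (hU : IsOpen U) (hKU : K ⊆ U) :
    ∃ f : 𝔼 → ℝ, ContDiff ℝ (⊤ : ℕ∞) f ∧ HasCompactSupport f ∧ tsupport f ⊆ U ∧
      (∀ x ∈ K, ∀ᶠ y in 𝓝 x, f y = 1) ∧ (∀ x, 0 ≤ f x) ∧ ∀ x, f x ≤ 1 := by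
  obtain ⟨L, hL, hKL, hLU⟩ := exists_compact_between hK hU hKU
  obtain ⟨f, h0, h1, hf⟩ := exists_contMDiffMap_zero_one_nhds_of_isClosed (n := (⊤ : ℕ∞))
    𝓘(ℝ, 𝔼) (s := (interior L)ᶜ) (t := K) isOpen_interior.isClosed_compl hK.isClosed
    (disjoint_compl_left_iff_subset.2 hKL)
  have hsupp : tsupport f ⊆ L := by
    refine closure_minimal (fun x hx => ?_) hL.isClosed
    by_contra hxL
    exact hx (h0.self_of_nhdsSet x fun h => hxL (interior_subset h))
  refine ⟨f, f.contMDiff.contDiff, hL.of_isClosed_subset (isClosed_tsupport _) hsupp,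
    hsupp.trans hLU, fun x hx => ?_, fun x => (hf x).1, fun x => (hf x).2⟩
  exact eventually_nhdsSet_iff_forall.1 h1 x hx

theorem exists_exhaustion {Ω : Set 𝔼} (hΩ : IsOpen Ω) :
    ∃ K : ℕ → Set 𝔼, (∀ k, IsCompact (K k)) ∧ (∀ k, K k ⊆ interior (K (k + 1))) ∧
      (∀ k, K k ⊆ Ω) ∧ ∀ L, IsCompact L → L ⊆ Ω → ∃ k, L ⊆ K k := by
  have : LocallyCompactSpace Ω := hΩ.locallyCompactSpace
  let C : CompactExhaustion Ω := default
  have h_int : ∀ k, image Subtype.val (C k) ⊆ interior (image Subtype.val (C (k + 1))) := by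
    intro k
    refine (image_mono (C.subset_interior_succ k)).trans ?_
    exact interior_maximal (image_mono interior_subset)
      (hΩ.isOpenMap_subtype_val _ isOpen_interior)
  have hsub : ∀ k, (image Subtype.val (C k) : Set 𝔼) ⊆ Ω := fun k => by
    rintro _ ⟨x, -, rfl⟩; exact x.2
  refine ⟨fun k => image Subtype.val (C k), fun k => (C.isCompact k).image continuous_subtype_val,
    h_int, hsub, fun L hL hLΩ => ?_⟩
  have hmono : Monotone fun k => (image Subtype.val (C k) : Set 𝔼) :=
    monotone_nat_of_le_succ fun k => (h_int k).trans interior_subset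
  obtain ⟨k, hk⟩ := hL.elim_directed_cover (fun k => interior (image Subtype.val (C k) : Set 𝔼))
    (fun k => isOpen_interior) (fun x hx => by
      have hx' : (⟨x, hLΩ hx⟩ : Ω) ∈ ⋃ k, C k := by rw [C.iUnion_eq]; trivial
      obtain ⟨k, hk⟩ := mem_iUnion.1 hx'
      exact mem_iUnion.2 ⟨k + 1, h_int k ⟨_, hk, rfl⟩⟩)
    (directed_of_isDirected_le fun i j hij => interior_mono (hmono hij))
  exact ⟨k, hk.trans interior_subset⟩

/-- A smooth partition of unity on an open set, with locally finite uniform neighbourhoods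
of its supports. -/
theorem exists_partition {Ω : Set 𝔼} (hΩ : IsOpen Ω) :
    ∃ (φ : ℕ → 𝔼 → ℝ) (r : ℕ → ℝ), (∀ i, ContDiff ℝ (⊤ : ℕ∞) (φ i)) ∧
      (∀ i, HasCompactSupport (φ i)) ∧ (∀ i, tsupport (φ i) ⊆ Ω) ∧ (∀ i x, 0 ≤ φ i x) ∧
      (∀ M x, ∑ i ∈ Finset.range M, φ i x ≤ 1) ∧ (∀ i, 0 < r i) ∧
      ∀ L, IsCompact L → L ⊆ Ω → ∃ N, ∀ M ≥ N,
        (∀ x ∈ L, ∀ᶠ y in 𝓝 x, ∑ i ∈ Finset.range M, φ i y = 1) ∧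
        ∀ x ∈ L, ∀ y, dist x y < r M → φ M y = 0 := by
  obtain ⟨K, hK, hKint, hKΩ, hKL⟩ := exists_exhaustion hΩ
  have hmono : Monotone K := monotone_nat_of_le_succ fun k => (hKint k).trans interior_subset
  choose ψ hψs hψc hψsupp hψ1 hψ0 hψle using fun k =>
    exists_smooth_cutoff (hK k) isOpen_interior (hKint k)
  set φ : ℕ → 𝔼 → ℝ := fun i => Nat.casesOn i (ψ 0) fun k x => ψ (k + 1) x - ψ k x with hφ
  have hsum : ∀ M x, ∑ i ∈ Finset.range (M + 1), φ i x = ψ M x := by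
    intro M x
    induction M with
    | zero => simp [hφ]
    | succ M ih => rw [Finset.sum_range_succ, ih]; simp [hφ]
  have htsupp : ∀ k, tsupport (ψ k) ⊆ K (k + 1) := fun k => (hψsupp k).trans interior_subset
  have hzero : ∀ k, ∀ x ∈ K k, ∀ᶠ y in 𝓝 x, φ (k + 1) y = 0 := by
    intro k x hx
    filter_upwards [hψ1 k x hx, hψ1 (k + 1) x (hmono k.le_succ hx)] with y h1 h2
    simp [hφ, h1, h2]
  have hr : ∀ k, ∃ r > 0, ∀ x ∈ K k, ∀ y, dist x y < r → φ (k + 1) y = 0 := by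
    intro k
    have hUo : IsOpen (interior {y | φ (k + 1) y = 0}) := isOpen_interior
    obtain ⟨r, hr, h⟩ := (hK k).exists_thickening_subset_open hUo
      fun x hx => mem_interior_iff_mem_nhds.2 (hzero k x hx)
    refine ⟨r, hr, fun x hx y hxy => ?_⟩
    exact interior_subset (s := {y | φ (k + 1) y = 0})
      (h (mem_thickening_iff.2 ⟨x, hx, by rwa [dist_comm]⟩))
  choose r hr0 hr using hr
  have hφtsupp : ∀ i, tsupport (φ i) ⊆ K (i + 1) := by
    intro i
    cases i with
    | zero => exact htsupp 0
    | succ k =>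
      refine (tsupport_sub (ψ (k + 1)) (ψ k)).trans (union_subset (htsupp _) ?_)
      exact (htsupp k).trans (hmono (Nat.le_succ _))
  refine ⟨φ, fun i => Nat.casesOn i 1 r, fun i => ?_, fun i => ?_,
    fun i => (hφtsupp i).trans (hKΩ _), fun i x => ?_, fun M x => ?_, fun i => ?_, ?_⟩
  · cases i with
    | zero => exact hψs 0
    | succ k => exact (hψs (k + 1)).sub (hψs k)
  · exact (hK _).of_isClosed_subset (isClosed_tsupport _) (hφtsupp i)
  · cases i with
    | zero => exact hψ0 0 x
    | succ k =>
      by_cases hx : x ∈ tsupport (ψ k)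
      · have := (hψ1 (k + 1) x (htsupp k hx)).self_of_nhds
        simp [hφ, this, hψle]
      · simp [hφ, image_eq_zero_of_notMem_tsupport hx, hψ0]
  · cases M with
    | zero => simp
    | succ M => rw [hsum]; exact hψle M x
  · cases i with
    | zero => exact one_pos
    | succ k => exact hr0 k
  · intro L hL hLΩ
    obtain ⟨k, hk⟩ := hKL L hL hLΩ
    refine ⟨k + 1, fun M hM => ?_⟩
    obtain ⟨m, rfl⟩ : ∃ m, M = m + 1 := ⟨M - 1, by omega⟩
    have hLm : L ⊆ K m := hk.trans (hmono (by omega))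
    refine ⟨fun x hx => ?_, fun x hx y hxy => hr m x (hLm hx) y hxy⟩
    filter_upwards [hψ1 m x (hLm hx)] with y hy
    rw [hsum, hy]

theorem integrable_mollify (η : ContDiffBump (0 : 𝔼)) {f : 𝔼 → ℝ} (hf : Integrable f) :
    Integrable (η ⊛ f) :=
  η.integrable_normed.integrable_convolution _ hf

theorem integrable_mollify_kernel (η : ContDiffBump (0 : 𝔼)) {f : 𝔼 → ℝ} (hf : Integrable f)
    (x : 𝔼) : Integrable fun y => η.normed volume (x - y) * f y := by
  obtain ⟨C, hC⟩ := η.hasCompactSupport_normed.exists_bound_of_continuous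
    (η.continuous_normed (μ := volume))
  exact hf.bdd_mul (c := C) (by
    have := η.continuous_normed (μ := volume)
    fun_prop) (Eventually.of_forall fun y => hC _)

theorem abs_mollify_le (η : ContDiffBump (0 : 𝔼)) (f : 𝔼 → ℝ) (x : 𝔼) :
    |(η ⊛ f) x| ≤ (η ⊛ fun y => |f y|) x := by
  rw [convolution_lsmul_swap, convolution_lsmul_swap, ← Real.norm_eq_abs]
  refine (norm_integral_le_integral_norm _).trans_eq (integral_congr_ae ?_)
  refine Eventually.of_forall fun y => ?_
  simp [abs_of_nonneg (η.nonneg_normed _)]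

theorem integral_abs_mollify_le (η : ContDiffBump (0 : 𝔼)) {f : 𝔼 → ℝ} (hf : Integrable f) :
    ∫ x, |(η ⊛ f) x| ≤ ∫ x, |f x| := by
  calc _ ≤ ∫ x, (η ⊛ fun y => |f y|) x :=
        integral_mono (integrable_mollify η hf).abs (integrable_mollify η hf.abs)
          (abs_mollify_le η f)
    _ = ∫ x, |f x| := by
        rw [integral_convolution _ η.integrable_normed hf.abs, η.integral_normed]
        simp

theorem mollify_eq_zero (η : ContDiffBump (0 : 𝔼)) {f : 𝔼 → ℝ} {x : 𝔼}
    (h : ∀ y, dist x y < η.rOut → f y = 0) :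
    (η ⊛ f) x = 0 := by
  rw [convolution_lsmul_swap]
  refine integral_eq_zero_of_ae (Eventually.of_forall fun y => ?_)
  by_cases hy : dist x y < η.rOut
  · simp [h y hy]
  · have : x - y ∉ Function.support (η.normed (volume : Measure 𝔼)) := by
      rw [η.support_normed_eq]
      simpa [dist_eq_norm] using hy
    simp [Function.notMem_support.1 this]

theorem contDiff_mollify (η : ContDiffBump (0 : 𝔼)) {f : 𝔼 → ℝ} (hf : Integrable f) :
    ContDiff ℝ (⊤ : ℕ∞) (η ⊛ f) :=
  η.hasCompactSupport_normed.contDiff_convolution_left _ η.contDiff_normed hf.locallyIntegrable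

theorem integral_abs_mollify_sub_le_of_continuous {h : 𝔼 → ℝ} (hc : Continuous h)
    (hs : HasCompactSupport h) {ε : ℝ} (hε : 0 < ε) :
    ∃ δ > 0, ∀ η : ContDiffBump (0 : 𝔼), η.rOut < δ →
      ∫ x, |(η ⊛ h) x - h x| ≤ ε := by
  set K := cthickening 1 (tsupport h) with hK
  have hKc : IsCompact K := hs.isCompact.cthickening
  set V := volume.real K with hV
  have hV0 : 0 ≤ V := measureReal_nonneg
  obtain ⟨δ, hδ, hu⟩ := Metric.uniformContinuous_iff.1
    (hs.uniformContinuous_of_continuous hc) (ε / (V + 1)) (by positivity)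
  refine ⟨min δ 1, by positivity, fun η hη => ?_⟩
  have hpt : ∀ x, |(η ⊛ h) x - h x| ≤
      K.indicator (fun _ => ε / (V + 1)) x := by
    intro x
    by_cases hx : x ∈ K
    · rw [indicator_of_mem hx, ← Real.dist_eq]
      exact η.dist_normed_convolution_le hc.aestronglyMeasurable fun y hy =>
        (hu ((mem_ball.1 hy).trans (hη.trans_le (min_le_left _ _)))).le
    · have hzero : ∀ y, dist x y < η.rOut → h y = 0 := by
        intro y hy
        by_contra hne
        refine hx (mem_cthickening_of_dist_le x y 1 _ (subset_tsupport _ hne) ?_)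
        exact (hy.trans (hη.trans_le (min_le_right _ _))).le
      rw [indicator_of_notMem hx, mollify_eq_zero η hzero, hzero x (by simpa using η.rOut_pos)]
      simp
  have hfin : volume K ≠ ⊤ := hKc.measure_lt_top.ne
  have hi : Integrable (K.indicator fun _ : 𝔼 => ε / (V + 1)) :=
    (integrable_indicator_iff hKc.measurableSet).2 (integrableOn_const hfin)
  calc _ ≤ ∫ x, K.indicator (fun _ : 𝔼 => ε / (V + 1)) x :=
        integral_mono_of_nonneg (Eventually.of_forall fun _ => abs_nonneg _) hi
          (Eventually.of_forall hpt)
    _ = V * (ε / (V + 1)) := by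
        rw [integral_indicator hKc.measurableSet, setIntegral_const, smul_eq_mul]
    _ ≤ ε := by
        rw [mul_div_assoc', div_le_iff₀ (by positivity)]
        nlinarith

theorem integral_abs_mollify_sub_le {f : 𝔼 → ℝ} (hf : Integrable f) {ε : ℝ} (hε : 0 < ε) :
    ∃ δ > 0, ∀ η : ContDiffBump (0 : 𝔼), η.rOut < δ →
      ∫ x, |(η ⊛ f) x - f x| ≤ ε := by
  obtain ⟨h, hs, hfh, hc, hi⟩ := hf.exists_hasCompactSupport_integral_sub_le
    (show 0 < ε / 3 by positivity)
  obtain ⟨δ, hδ, H⟩ := integral_abs_mollify_sub_le_of_continuous hc hs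
    (show 0 < ε / 3 by positivity)
  refine ⟨δ, hδ, fun η hη => ?_⟩
  have h1 := H η hη
  have h2 := integral_abs_mollify_le η (hf.sub hi)
  have hsub : ∀ x, (η ⊛ (f - h)) x =
      (η ⊛ f) x -
      (η ⊛ h) x := by
    intro x
    simp only [convolution_lsmul_swap, smul_eq_mul, Pi.sub_apply, mul_sub]
    exact integral_sub (integrable_mollify_kernel η hf x) (integrable_mollify_kernel η hi x)
  simp only [hsub, Pi.sub_apply] at h2
  simp only [Real.norm_eq_abs] at hfh
  have hmf := integrable_mollify η hf
  have hmh := integrable_mollify η hi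
  have i1 : Integrable fun x => |(η ⊛ f) x - (η ⊛ h) x| := (hmf.sub hmh).abs
  have i2 : Integrable fun x => |(η ⊛ h) x - h x| := (hmh.sub hi).abs
  have i3 : Integrable fun x => |f x - h x| := (hf.sub hi).abs
  have i12 : Integrable fun x => |(η ⊛ f) x - (η ⊛ h) x| + |(η ⊛ h) x - h x| := i1.add i2
  calc _ ≤ ∫ x, (|(η ⊛ f) x - (η ⊛ h) x| + |(η ⊛ h) x - h x| + |f x - h x|) := by
        refine integral_mono (hmf.sub hf).abs (i12.add i3) fun x => ?_
        simp only
        rw [abs_sub_comm (f x) (h x)]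
        refine (abs_sub_le _ (h x) _).trans ?_
        gcongr
        exact abs_sub_le _ _ _
    _ ≤ ε := by
        rw [integral_add i12 i3, integral_add i1 i2]
        linarith

/-- Mollification with an even kernel is symmetric for the `L²` pairing. -/
theorem integral_mollify_mul (η : ContDiffBump (0 : 𝔼)) {f T : 𝔼 → ℝ} (hf : Integrable f)
    (hT : Integrable T) :
    ∫ x, (η ⊛ f) x * T x =
      ∫ x, f x * (η ⊛ T) x := by
  obtain ⟨C, hC⟩ := η.hasCompactSupport_normed.exists_bound_of_continuous
    (η.continuous_normed (μ := volume))
  have hcont := η.continuous_normed (μ := volume)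
  have hTf : Integrable (fun z : 𝔼 × 𝔼 => η.normed volume (z.1 - z.2) * (T z.1 * f z.2))
      (volume.prod volume) :=
    (hT.mul_prod hf).bdd_mul (c := C) (by fun_prop) (Eventually.of_forall fun z => hC _)
  calc _ = ∫ x, ∫ y, η.normed volume (x - y) * (T x * f y) := by
        congr 1; ext x
        rw [convolution_lsmul_swap, ← integral_mul_const]
        congr 1; ext y; simp only [smul_eq_mul]; ring
    _ = ∫ y, ∫ x, η.normed volume (x - y) * (T x * f y) := integral_integral_swap hTf
    _ = _ := by
        congr 1; ext y
        rw [convolution_lsmul_swap, ← integral_const_mul]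
        congr 1; ext x
        rw [← η.normed_neg (x - y), neg_sub, smul_eq_mul]; ring

theorem fderiv_mollify (η : ContDiffBump (0 : 𝔼)) {g : 𝔼 → ℝ} (hg : ContDiff ℝ 1 g)
    (hs : HasCompactSupport g) (x e : 𝔼) :
    fderiv ℝ (η ⊛ g) x e =
      (η ⊛ fun y => fderiv ℝ g y e) x := by
  have hη := (η.integrable_normed (μ := (volume : Measure 𝔼))).locallyIntegrable
  rw [(hs.hasFDerivAt_convolution_right _ hη hg x).fderiv,
    convolution_precompR_apply _ hη (hs.fderiv ℝ) (hg.continuous_fderiv one_ne_zero)]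

/-- Averaging the mollifications of a field bounded by `1` with weights of total mass at most `1`
produces a field bounded by `1`. -/
theorem sum_sq_sum_mul_mollify_le {ι κ : Type*} [Fintype κ] (s : Finset ι)
    (η : ι → ContDiffBump (0 : 𝔼)) {c : ι → ℝ} (hc : ∀ i, 0 ≤ c i) (hc1 : ∑ i ∈ s, c i ≤ 1)
    {g : κ → 𝔼 → ℝ} (hgi : ∀ j, Integrable (g j)) (hg1 : ∀ x, ∑ j, g j x ^ 2 ≤ 1) (x : 𝔼) :
    ∑ j, (∑ i ∈ s, c i *
      (η i ⊛ g j) x) ^ 2 ≤ 1 := by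
  set a : κ → ℝ := fun j => ∑ i ∈ s, c i *
      (η i ⊛ g j) x with ha
  set S := ∑ j, a j ^ 2 with hS
  have hS0 : 0 ≤ S := Finset.sum_nonneg fun j _ => sq_nonneg _
  have hcs : ∀ y, ∑ j, a j * g j y ≤ √S := by
    intro y
    refine (Real.sum_mul_le_sqrt_mul_sqrt _ _ _).trans ?_
    exact mul_le_of_le_one_right (Real.sqrt_nonneg _) (Real.sqrt_le_one.2 (hg1 y))
  have hpair : ∀ i, ∑ j, a j *
      (η i ⊛ g j) x ≤ √S := by
    intro i
    have hi : ∀ j, Integrable fun y => a j * ((η i).normed volume (x - y) * g j y) := fun j =>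
      (integrable_mollify_kernel (η i) (hgi j) x).const_mul _
    calc _ = ∫ y, ∑ j, a j * ((η i).normed volume (x - y) * g j y) := by
          rw [integral_finsetSum _ fun j _ => hi j]
          simp only [convolution_lsmul_swap, smul_eq_mul, integral_const_mul]
      _ ≤ ∫ y, (η i).normed volume (x - y) * √S := by
          refine integral_mono (integrable_finsetSum _ fun j _ => hi j)
            (((η i).integrable_normed.comp_sub_left x).mul_const _) fun y => ?_
          calc _ = (η i).normed volume (x - y) * ∑ j, a j * g j y := by
                rw [Finset.mul_sum]
                exact Finset.sum_congr rfl fun j _ => by ring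
            _ ≤ _ := mul_le_mul_of_nonneg_left (hcs y) ((η i).nonneg_normed _)
      _ = √S := by
          rw [integral_mul_const, integral_sub_left_eq_self, (η i).integral_normed, one_mul]
  have key : S ≤ √S := by
    calc S = ∑ i ∈ s, c i * ∑ j, a j *
          (η i ⊛ g j) x := by
          simp only [Finset.mul_sum]
          rw [Finset.sum_comm, hS]
          refine Finset.sum_congr rfl fun j _ => ?_
          rw [sq]
          conv_lhs => rw [ha]
          simp only
          rw [Finset.sum_mul]
          exact Finset.sum_congr rfl fun i _ => by ring
      _ ≤ ∑ i ∈ s, c i * √S := Finset.sum_le_sum fun i _ =>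
          mul_le_mul_of_nonneg_left (hpair i) (hc i)
      _ ≤ √S := by
          rw [← Finset.sum_mul]
          exact mul_le_of_le_one_left (Real.sqrt_nonneg _) hc1
  have hsq := Real.mul_self_sqrt hS0
  nlinarith [Real.sqrt_nonneg S]

/-- The zeroth-order component plus the divergence of the remaining components. -/
noncomputable def weightedDiv (g : Fin (n + 1) → 𝔼 → ℝ) (x : 𝔼) : ℝ :=
  g (Fin.last n) x + ∑ i : Fin n, fderiv ℝ (g i.castSucc) x (EuclideanSpace.single i 1)

section Admissible

variable {Ω : Set (EuclideanSpace ℝ (Fin n))} {g : Fin (n + 1) → EuclideanSpace ℝ (Fin n) → ℝ}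

theorem Admissible.ofReal_le_Ffun (hg : Admissible n Ω g) (v : 𝔼 → ℝ) :
    ENNReal.ofReal (∫ x in Ω, v x * weightedDiv g x) ≤ Ffun n Ω v :=
  le_iSup (fun g : { g // Admissible n Ω g } =>
    ENNReal.ofReal (∫ x in Ω, v x * weightedDiv g.1 x)) ⟨g, hg⟩

theorem Admissible.continuous (hg : Admissible n Ω g) (i : Fin (n + 1)) : Continuous (g i) :=
  (hg.1 i).continuous

theorem Admissible.continuous_fderiv (hg : Admissible n Ω g) (i : Fin (n + 1)) (e : 𝔼) :
    Continuous fun x => fderiv ℝ (g i) x e :=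
  ((hg.1 i).continuous_fderiv one_ne_zero).clm_apply continuous_const

theorem Admissible.continuous_weightedDiv (hg : Admissible n Ω g) :
    Continuous (weightedDiv g) :=
  (hg.continuous _).add (continuous_finsetSum _ fun _ _ => hg.continuous_fderiv _ _)

theorem Admissible.abs_le_one (hg : Admissible n Ω g) (i : Fin (n + 1)) (x : 𝔼) :
    |g i x| ≤ 1 := by
  rw [← sq_le_one_iff_abs_le_one]
  exact (Finset.single_le_sum (f := fun i => g i x ^ 2) (fun j _ => sq_nonneg _)
    (Finset.mem_univ i)).trans (hg.2.2.2 x)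

theorem Admissible.exists_compact (hg : Admissible n Ω g) :
    ∃ L, IsCompact L ∧ L ⊆ Ω ∧ ∀ i, tsupport (g i) ⊆ L :=
  ⟨⋃ i, tsupport (g i), isCompact_iUnion fun i => hg.2.1 i,
    iUnion_subset hg.2.2.1, fun i => subset_iUnion (fun i => tsupport (g i)) i⟩

theorem weightedDiv_eq_zero {L : Set 𝔼} (h : ∀ i, tsupport (g i) ⊆ L) {x : 𝔼} (hx : x ∉ L) :
    weightedDiv g x = 0 := by
  have h1 : g (Fin.last n) x = 0 := image_eq_zero_of_notMem_tsupport fun hx' => hx (h _ hx')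
  have h2 : ∀ i, fderiv ℝ (g i) x = 0 := fun i =>
    image_eq_zero_of_notMem_tsupport fun hx' => hx (h _ (tsupport_fderiv_subset ℝ hx'))
  simp [weightedDiv, h1, h2]

theorem Admissible.hasCompactSupport_weightedDiv (hg : Admissible n Ω g) :
    HasCompactSupport (weightedDiv g) := by
  obtain ⟨L, hL, -, h⟩ := hg.exists_compact
  exact HasCompactSupport.intro hL fun x hx => weightedDiv_eq_zero h hx

theorem Admissible.integrable_mul_weightedDiv (hg : Admissible n Ω g) {v : 𝔼 → ℝ}
    {μ : Measure 𝔼} (hv : Integrable v μ) : Integrable (fun x => v x * weightedDiv g x) μ := by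
  obtain ⟨C, hC⟩ := hg.hasCompactSupport_weightedDiv.exists_bound_of_continuous
    hg.continuous_weightedDiv
  exact hv.mul_bdd (c := C) hg.continuous_weightedDiv.aestronglyMeasurable
    (Eventually.of_forall hC)

end Admissible

theorem integrable_mul_of_tsupport_subset_s8 {Ω : Set 𝔼} (hΩ : IsOpen Ω) {w h : 𝔼 → ℝ}
    (hw : ContinuousOn w Ω) (hh : Continuous h) (hs : HasCompactSupport h) (hsub : tsupport h ⊆ Ω) :
    Integrable fun x => w x * h x := by
  refine Continuous.integrable_of_hasCompactSupport ?_ (hs.mul_left (f := w))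
  refine (hw.mul hh.continuousOn).continuous_of_tsupport_subset hΩ ?_
  exact (tsupport_mul_subset_right (f := w)).trans hsub

theorem setIntegral_mul_weightedDiv {Ω : Set 𝔼} (hΩ : IsOpen Ω) {w : 𝔼 → ℝ}
    (hw : ContDiffOn ℝ 1 w Ω) {g : Fin (n + 1) → 𝔼 → ℝ} (hg : Admissible n Ω g) :
    ∫ x in Ω, w x * weightedDiv g x = ∫ x in Ω, (w x * g (Fin.last n) x -
      ∑ i : Fin n, fderiv ℝ w x (EuclideanSpace.single i 1) * g i.castSucc x) := by
  have hg0 : ∀ i, ∀ x ∉ Ω, g i x = 0 := fun i x hx =>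
    image_eq_zero_of_notMem_tsupport fun hx' => hx (hg.2.2.1 i hx')
  rw [setIntegral_eq_integral_of_forall_compl_eq_zero fun x hx => by
      rw [weightedDiv_eq_zero hg.2.2.1 hx, mul_zero],
    setIntegral_eq_integral_of_forall_compl_eq_zero fun x hx => by simp [hg0 _ x hx]]
  have hdw : ∀ e, ContinuousOn (fun x => fderiv ℝ w x e) Ω := fun e =>
    (hw.continuousOn_fderiv_of_isOpen hΩ le_rfl).clm_apply continuousOn_const
  have i0 : ∀ i, Integrable fun x => w x * g i x := fun i =>
    integrable_mul_of_tsupport_subset_s8 hΩ hw.continuousOn (hg.continuous i) (hg.2.1 i) (hg.2.2.1 i)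
  have i1 : ∀ i e, Integrable fun x => w x * fderiv ℝ (g i) x e := fun i e =>
    integrable_mul_of_tsupport_subset_s8 hΩ hw.continuousOn (hg.continuous_fderiv i e)
      ((hg.2.1 i).fderiv_apply ℝ e) ((tsupport_fderiv_apply_subset ℝ e).trans (hg.2.2.1 i))
  have i2 : ∀ i e, Integrable fun x => fderiv ℝ w x e * g i x := fun i e =>
    integrable_mul_of_tsupport_subset_s8 hΩ (hdw e) (hg.continuous i) (hg.2.1 i) (hg.2.2.1 i)
  simp only [weightedDiv, mul_add, Finset.mul_sum]
  rw [integral_add (i0 _) (integrable_finsetSum _ fun i _ => i1 _ _),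
    integral_sub (i0 _) (integrable_finsetSum _ fun i _ => i2 _ _),
    integral_finsetSum _ fun i _ => i1 _ _, integral_finsetSum _ fun i _ => i2 _ _,
    sub_eq_add_neg, ← Finset.sum_neg_distrib]
  congr 1
  refine Finset.sum_congr rfl fun i _ => ?_
  refine integral_mul_fderiv_eq_neg_fderiv_mul_of_integrable (i2 _ _) (i1 _ _) (i0 _)
    (fun x hx => ?_) fun x _ => ((hg.1 _).differentiable one_ne_zero) x
  exact (hw.differentiableOn one_ne_zero).differentiableAt (hΩ.mem_nhds (hg.2.2.1 _ hx))

theorem sum_sq_apply_single (D : 𝔼 →L[ℝ] ℝ) :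
    ∑ i, D (EuclideanSpace.single i 1) ^ 2 = ‖D‖ ^ 2 := by
  obtain ⟨y, rfl⟩ := (InnerProductSpace.toDual ℝ 𝔼).surjective D
  rw [LinearIsometryEquiv.norm_map, EuclideanSpace.norm_sq_eq]
  simp [EuclideanSpace.inner_single_right]

theorem abs_mul_sub_sum_le (a : ℝ) (D : 𝔼 →L[ℝ] ℝ) (b : Fin (n + 1) → ℝ)
    (hb : ∑ i, b i ^ 2 ≤ 1) :
    |a * b (Fin.last n) - ∑ i : Fin n, D (EuclideanSpace.single i 1) * b i.castSucc| ≤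
      √(a ^ 2 + ‖D‖ ^ 2) := by
  set c : Fin (n + 1) → ℝ := Fin.snoc (fun i : Fin n => -D (EuclideanSpace.single i 1)) a
    with hc
  have h1 : a * b (Fin.last n) - ∑ i : Fin n, D (EuclideanSpace.single i 1) * b i.castSucc =
      ∑ i, c i * b i := by
    rw [Fin.sum_univ_castSucc]; simp [hc]; ring
  have h2 : a ^ 2 + ‖D‖ ^ 2 = ∑ i, c i ^ 2 := by
    rw [Fin.sum_univ_castSucc, ← sum_sq_apply_single]; simp [hc]; ring
  rw [h1, h2]
  refine Real.abs_le_sqrt ((Finset.sum_mul_sq_le_sq_mul_sq _ _ _).trans ?_)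
  exact mul_le_of_le_one_right (Finset.sum_nonneg fun i _ => sq_nonneg _) hb

/-- Duality bound: each test field yields a lower bound for the classical functional. -/
theorem ofReal_setIntegral_mul_weightedDiv_le {Ω : Set 𝔼} (hΩ : IsOpen Ω) {w : 𝔼 → ℝ}
    (hw : ContDiffOn ℝ 1 w Ω) {g : Fin (n + 1) → 𝔼 → ℝ} (hg : Admissible n Ω g) :
    ENNReal.ofReal (∫ x in Ω, w x * weightedDiv g x) ≤
      ∫⁻ x in Ω, ENNReal.ofReal √(w x ^ 2 + ‖fderivWithin ℝ w Ω x‖ ^ 2) := by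
  rw [setIntegral_mul_weightedDiv hΩ hw hg]
  refine (Real.ofReal_le_enorm _).trans ((enorm_integral_le_lintegral_enorm _).trans ?_)
  refine setLIntegral_mono' hΩ.measurableSet fun x hx => ?_
  rw [fderivWithin_of_isOpen hΩ hx, Real.enorm_eq_ofReal_abs]
  exact ENNReal.ofReal_le_ofReal (abs_mul_sub_sum_le _ _ (fun i => g i x) (hg.2.2.2 x))

theorem contDiff_mul_of_tsupport_subset {Ω : Set 𝔼} (hΩ : IsOpen Ω) {χ f : 𝔼 → ℝ}
    {m : WithTop ℕ∞} (hχ : ContDiff ℝ m χ) (hsub : tsupport χ ⊆ Ω) (hf : ContDiffOn ℝ m f Ω) :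
    ContDiff ℝ m fun x => χ x * f x := by
  rw [contDiff_iff_contDiffAt]
  intro x
  by_cases hx : x ∈ Ω
  · exact hχ.contDiffAt.mul (hf.contDiffAt (hΩ.mem_nhds hx))
  · have h0 : (fun x => χ x * f x) =ᶠ[𝓝 x] fun _ => 0 := by
      filter_upwards [(isClosed_tsupport χ).isOpen_compl.mem_nhds fun h => hx (hsub h)] with y hy
      rw [image_eq_zero_of_notMem_tsupport hy, zero_mul]
    exact contDiffAt_const.congr_of_eventuallyEq h0

/-- For smooth functions the dual functional dominates the classical integral. -/
theorem lintegral_le_Ffun {Ω : Set 𝔼} (hΩ : IsOpen Ω) {w : 𝔼 → ℝ}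
    (hw : ContDiffOn ℝ (⊤ : ℕ∞) w Ω) :
    ∫⁻ x in Ω, ENNReal.ofReal √(w x ^ 2 + ‖fderivWithin ℝ w Ω x‖ ^ 2) ≤ Ffun n Ω w := by
  obtain ⟨K, hK, hKint, hKΩ, hKL⟩ := exists_exhaustion hΩ
  choose χ hχs hχc hχΩ hχ1 hχ0 hχle using fun k => exists_smooth_cutoff (hK k) hΩ (hKΩ k)
  have hw1 : ContDiffOn ℝ 1 w Ω := hw.of_le (by exact_mod_cast le_top)
  have hD : ∀ e, ContDiffOn ℝ 1 (fun x => fderiv ℝ w x e) Ω := fun e =>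
    ((hw.fderiv_of_isOpen (m := ∞) hΩ (by simp)).of_le (by exact_mod_cast le_top)).clm_apply
      contDiffOn_const
  set c : Fin (n + 1) → 𝔼 → ℝ :=
    Fin.snoc (fun (i : Fin n) x => -fderiv ℝ w x (EuclideanSpace.single i 1)) w with hc
  have hcs : ∀ i, ContDiffOn ℝ 1 (c i) Ω := by
    intro i
    refine Fin.lastCases ?_ (fun i => ?_) i
    · simpa [hc] using hw1
    · simpa [hc] using (hD (EuclideanSpace.single i 1)).neg
  set S : 𝔼 → ℝ := fun x => ∑ i, c i x ^ 2 with hS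
  have hS0 : ∀ x, 0 ≤ S x := fun x => Finset.sum_nonneg fun i _ => sq_nonneg _
  have hSs : ContDiffOn ℝ 1 S Ω := ContDiffOn.sum fun i _ => (hcs i).pow 2
  have hSw : ∀ x, w x ^ 2 + ‖fderiv ℝ w x‖ ^ 2 = S x := by
    intro x
    rw [← sum_sq_apply_single]
    simp only [hS]
    rw [Fin.sum_univ_castSucc]; simp [hc]; ring
  set δ : ℕ → ℝ := fun k => 1 / ((k : ℝ) + 1) with hδ
  have hδ0 : ∀ k, 0 < δ k := fun k => Nat.one_div_pos_of_nat
  have hpos : ∀ k x, 0 < δ k + S x := fun k x => add_pos_of_pos_of_nonneg (hδ0 k) (hS0 x)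
  have hq : ∀ k, ContDiffOn ℝ 1 (fun x => √(δ k + S x)) Ω := fun k =>
    (contDiffOn_const.add hSs).sqrt fun x _ => (hpos k x).ne'
  set g : ℕ → Fin (n + 1) → 𝔼 → ℝ := fun k i x => χ k x * (c i x / √(δ k + S x)) with hg
  have hadm : ∀ k, Admissible n Ω (g k) := by
    intro k
    refine ⟨fun i => ?_, fun i => (hχc k).mul_right,
      fun i => (tsupport_mul_subset_left).trans (hχΩ k), fun x => ?_⟩
    · exact contDiff_mul_of_tsupport_subset hΩ ((hχs k).of_le (by exact_mod_cast le_top)) (hχΩ k)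
        ((hcs i).div (hq k) fun x _ => (Real.sqrt_pos.2 (hpos k x)).ne')
    · have h1 : ∑ i, g k i x ^ 2 = χ k x ^ 2 * (S x / (δ k + S x)) := by
        have h2 : ∀ i, g k i x ^ 2 = χ k x ^ 2 * (c i x ^ 2 / (δ k + S x)) := fun i => by
          rw [← Real.sq_sqrt (hpos k x).le, ← div_pow, ← mul_pow]
        simp_rw [h2, ← Finset.mul_sum, ← Finset.sum_div, hS]
      rw [h1]
      refine mul_le_one₀ (pow_le_one₀ (hχ0 k x) (hχle k x)) (div_nonneg (hS0 x) (hpos k x).le) ?_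
      rw [div_le_one (hpos k x)]
      linarith [hδ0 k]
  set f : ℕ → 𝔼 → ℝ := fun k x => χ k x * (S x / √(δ k + S x)) with hf
  have hf0 : ∀ k x, 0 ≤ f k x := fun k x =>
    mul_nonneg (hχ0 k x) (div_nonneg (hS0 x) (Real.sqrt_nonneg _))
  have hfc : ∀ k, Continuous (f k) := fun k =>
    (contDiff_mul_of_tsupport_subset hΩ ((hχs k).of_le (by exact_mod_cast le_top)) (hχΩ k)
        (hSs.div (hq k) fun x _ => (Real.sqrt_pos.2 (hpos k x)).ne')).continuous
  have hfi : ∀ k, Integrable (f k) := fun k =>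
    (hfc k).integrable_of_hasCompactSupport (hχc k).mul_right
  have hle : ∀ k, ∫⁻ x in Ω, ENNReal.ofReal (f k x) ≤ Ffun n Ω w := by
    intro k
    refine le_trans (le_of_eq ?_) ((hadm k).ofReal_le_Ffun w)
    rw [setIntegral_mul_weightedDiv hΩ hw1 (hadm k), ← ofReal_integral_eq_lintegral_ofReal
      (hfi k).integrableOn (Eventually.of_forall (hf0 k))]
    congr 2; ext x
    calc f k x = ∑ i, c i x * g k i x := by
          simp only [hf, hg, hS, Finset.sum_div, Finset.mul_sum]
          exact Finset.sum_congr rfl fun i _ => by ring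
      _ = _ := by
          rw [Fin.sum_univ_castSucc]; simp [hc]; ring
  have hlim : ∀ x ∈ Ω, Tendsto (fun k => ENNReal.ofReal (f k x)) atTop
      (𝓝 (ENNReal.ofReal √(S x))) := by
    intro x hx
    refine (ENNReal.continuous_ofReal.tendsto _).comp ?_
    obtain ⟨k₀, hk₀⟩ := hKL {x} isCompact_singleton (singleton_subset_iff.2 hx)
    have hmono : Monotone K := monotone_nat_of_le_succ fun k => (hKint k).trans interior_subset
    have hev : ∀ᶠ k in atTop, S x / √(δ k + S x) = f k x := by
      filter_upwards [eventually_ge_atTop k₀] with k hk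
      simp [hf, (hχ1 k x (hmono hk (hk₀ rfl))).self_of_nhds]
    refine Tendsto.congr' hev ?_
    rcases (hS0 x).eq_or_lt with h0 | h0
    · simp [← h0]
    · have h1 : Tendsto (fun k => √(δ k + S x)) atTop (𝓝 √(0 + S x)) :=
        (Real.continuous_sqrt.tendsto _).comp
          (tendsto_one_div_add_atTop_nhds_zero_nat.add tendsto_const_nhds)
      have h2 : Tendsto (fun k => S x / √(δ k + S x)) atTop (𝓝 (S x / √(0 + S x))) :=
        tendsto_const_nhds.div h1 (by rw [zero_add]; exact (Real.sqrt_pos.2 h0).ne')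
      simpa using h2
  calc _ = ∫⁻ x in Ω, liminf (fun k => ENNReal.ofReal (f k x)) atTop := by
        refine setLIntegral_congr_fun hΩ.measurableSet fun x hx => ?_
        rw [(hlim x hx).liminf_eq, ← hSw, fderivWithin_of_isOpen hΩ hx]
    _ ≤ liminf (fun k => ∫⁻ x in Ω, ENNReal.ofReal (f k x)) atTop :=
        lintegral_liminf_le fun k => (hfc k).measurable.ennreal_ofReal
    _ ≤ Ffun n Ω w := by
        refine (liminf_le_liminf (Eventually.of_forall hle)).trans ?_
        simp

theorem mollify_weightedDiv {Ω : Set 𝔼} (η : ContDiffBump (0 : 𝔼))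
    {g : Fin (n + 1) → 𝔼 → ℝ} (hg : Admissible n Ω g) (x : 𝔼) :
    (η ⊛ weightedDiv g) x = weightedDiv (fun k => η ⊛ g k) x := by
  have hi : ∀ k, Integrable (g k) := fun k =>
    (hg.continuous k).integrable_of_hasCompactSupport (hg.2.1 k)
  have hdi : ∀ k e, Integrable fun y => fderiv ℝ (g k) y e := fun k e =>
    (hg.continuous_fderiv k e).integrable_of_hasCompactSupport ((hg.2.1 k).fderiv_apply ℝ e)
  simp only [weightedDiv, fderiv_mollify η (hg.1 _) (hg.2.1 _)]
  simp only [convolution_lsmul_swap, smul_eq_mul, weightedDiv, mul_add, Finset.mul_sum]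
  rw [integral_add (integrable_mollify_kernel η (hi _) x)
      (integrable_finsetSum _ fun j _ => integrable_mollify_kernel η (hdi _ _) x),
    integral_finsetSum _ fun j _ => integrable_mollify_kernel η (hdi _ _) x]

theorem weightedDiv_sum_mul {ι : Type*} (s : Finset ι) {φ : ι → 𝔼 → ℝ}
    {G : ι → Fin (n + 1) → 𝔼 → ℝ} (hφ : ∀ i, Differentiable ℝ (φ i))
    (hG : ∀ i k, Differentiable ℝ (G i k)) (x : 𝔼) :
    weightedDiv (fun k y => ∑ i ∈ s, φ i y * G i k y) x =
      ∑ i ∈ s, φ i x * weightedDiv (G i) x +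
      ∑ i ∈ s, ∑ j : Fin n,
        fderiv ℝ (φ i) x (EuclideanSpace.single j 1) * G i j.castSucc x := by
  have h : ∀ k, fderiv ℝ (fun y => ∑ i ∈ s, φ i y * G i k y) x =
      ∑ i ∈ s, (φ i x • fderiv ℝ (G i k) x + G i k x • fderiv ℝ (φ i) x) := by
    intro k
    rw [fderiv_fun_sum fun i _ => ((hφ i) x).fun_mul ((hG i k) x)]
    exact Finset.sum_congr rfl fun i _ => fderiv_fun_mul ((hφ i) x) ((hG i k) x)
  simp only [weightedDiv, h, FunLike.coe_sum, Finset.sum_apply, add_apply,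
    smul_apply, smul_eq_mul, mul_add, Finset.sum_add_distrib, Finset.mul_sum]
  rw [Finset.sum_comm (s := Finset.univ) (t := s), Finset.sum_comm (s := Finset.univ) (t := s),
    add_assoc]
  congr 2
  exact Finset.sum_congr rfl fun i _ => Finset.sum_congr rfl fun j _ => mul_comm _ _

theorem integrable_mul_of_hasCompactSupport {u h : 𝔼 → ℝ} (hu : Integrable u)
    (hc : Continuous h) (hs : HasCompactSupport h) : Integrable fun x => u x * h x := by
  obtain ⟨C, hC⟩ := hs.exists_bound_of_continuous hc
  exact hu.mul_bdd (c := C) hc.aestronglyMeasurable (Eventually.of_forall hC)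

/-- The mollified field obtained from an admissible field and a partition of unity is
admissible. -/
theorem Admissible.sum_mul_mollify {Ω : Set 𝔼} {ι : Type*} (s : Finset ι)
    (η : ι → ContDiffBump (0 : 𝔼)) {φ : ι → 𝔼 → ℝ} (hφs : ∀ i, ContDiff ℝ (⊤ : ℕ∞) (φ i))
    (hφc : ∀ i, HasCompactSupport (φ i)) (hφΩ : ∀ i, tsupport (φ i) ⊆ Ω)
    (hφ0 : ∀ i x, 0 ≤ φ i x) (hφ1 : ∀ x, ∑ i ∈ s, φ i x ≤ 1)
    {g : Fin (n + 1) → 𝔼 → ℝ} (hg : Admissible n Ω g) :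
    Admissible n Ω fun k x => ∑ i ∈ s, φ i x * (η i ⊛ g k) x := by
  have hi : ∀ k, Integrable (g k) := fun k =>
    (hg.continuous k).integrable_of_hasCompactSupport (hg.2.1 k)
  have hcl : IsClosed (⋃ i ∈ s, tsupport (φ i)) :=
    s.finite_toSet.isClosed_biUnion fun i _ => isClosed_tsupport _
  have hts : ∀ k, tsupport (fun x => ∑ i ∈ s, φ i x * (η i ⊛ g k) x) ⊆
      ⋃ i ∈ s, tsupport (φ i) := by
    intro k
    refine closure_minimal (fun x hx => ?_) hcl
    obtain ⟨i, his, hne⟩ := Finset.exists_ne_zero_of_sum_ne_zero hx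
    exact mem_biUnion his (subset_tsupport _ (left_ne_zero_of_mul hne))
  refine ⟨fun k => ?_, fun k => ?_, fun k => ?_, fun x => ?_⟩
  · exact ContDiff.sum fun i _ => ((hφs i).mul (contDiff_mollify (η i) (hi k))).of_le
      (by exact_mod_cast le_top)
  · exact (s.isCompact_biUnion fun i _ => hφc i).of_isClosed_subset (isClosed_tsupport _) (hts k)
  · exact (hts k).trans (iUnion₂_subset fun i _ => hφΩ i)
  · exact sum_sq_sum_mul_mollify_le s η (fun i => hφ0 i x) (hφ1 x) hi hg.2.2.2 x

/-- Testing a partition-of-unity mollification against an admissible field: the result is the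
pairing of the original function with another admissible field, up to commutator errors. -/
theorem integral_sum_mollify_mul_weightedDiv {Ω L : Set 𝔼} (s : Finset ℕ)
    (η : ℕ → ContDiffBump (0 : 𝔼)) {φ : ℕ → 𝔼 → ℝ} (hφs : ∀ i, ContDiff ℝ (⊤ : ℕ∞) (φ i))
    (hφc : ∀ i, HasCompactSupport (φ i))
    {g : Fin (n + 1) → 𝔼 → ℝ} (hg : Admissible n Ω g) (hgL : ∀ i, tsupport (g i) ⊆ L)
    (hsum : ∀ x ∈ L, ∀ᶠ y in 𝓝 x, ∑ i ∈ s, φ i y = 1) {u : 𝔼 → ℝ} (hu : Integrable u) :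
    ∫ x, (∑ i ∈ s, (η i ⊛ fun y => u y * φ i y) x) * weightedDiv g x =
      (∫ x, u x * weightedDiv (fun k x => ∑ i ∈ s, φ i x * (η i ⊛ g k) x) x) -
      ∑ i ∈ s, ∑ j : Fin n, ∫ x,
        ((η i ⊛ fun y => u y * fderiv ℝ (φ i) y (EuclideanSpace.single j 1)) x -
          u x * fderiv ℝ (φ i) x (EuclideanSpace.single j 1)) * g j.castSucc x := by
  have hgi : ∀ k, Integrable (g k) := fun k =>
    (hg.continuous k).integrable_of_hasCompactSupport (hg.2.1 k)
  have hwi : Integrable (weightedDiv g) :=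
    hg.continuous_weightedDiv.integrable_of_hasCompactSupport hg.hasCompactSupport_weightedDiv
  have hdc : ∀ i e, Continuous fun x => fderiv ℝ (φ i) x e := fun i e =>
    ((hφs i).continuous_fderiv (by simp)).clm_apply continuous_const
  have huφ : ∀ i, Integrable fun x => u x * φ i x := fun i =>
    integrable_mul_of_hasCompactSupport hu (hφs i).continuous (hφc i)
  have hud : ∀ i e, Integrable fun x => u x * fderiv ℝ (φ i) x e := fun i e =>
    integrable_mul_of_hasCompactSupport hu (hdc i e) ((hφc i).fderiv_apply ℝ e)
  have hGs : ∀ i k, ContDiff ℝ (⊤ : ℕ∞) (η i ⊛ g k) := fun i k => contDiff_mollify (η i) (hgi k)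
  have hWc : ∀ i, Continuous (weightedDiv fun k => η i ⊛ g k) := fun i =>
    (hGs i _).continuous.add (continuous_finsetSum _ fun j _ =>
      ((hGs i _).continuous_fderiv (by simp)).clm_apply continuous_const)
  have hmulg : ∀ {f : 𝔼 → ℝ}, Integrable f → ∀ k, Integrable fun x => f x * g k x :=
    fun hf k => integrable_mul_of_hasCompactSupport hf (hg.continuous k) (hg.2.1 k)
  have iA : ∀ i, Integrable fun x => u x * (φ i x * weightedDiv (fun k => η i ⊛ g k) x) := fun i =>
    integrable_mul_of_hasCompactSupport hu ((hφs i).continuous.mul (hWc i)) (hφc i).mul_right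
  have iB : ∀ i (j : Fin n), Integrable fun x => u x *
      (fderiv ℝ (φ i) x (EuclideanSpace.single j 1) * (η i ⊛ g j.castSucc) x) := fun i j =>
    integrable_mul_of_hasCompactSupport hu ((hdc i _).mul (hGs i _).continuous)
      ((hφc i).fderiv_apply ℝ _).mul_right
  have hleft : ∫ x, (∑ i ∈ s, (η i ⊛ fun y => u y * φ i y) x) * weightedDiv g x =
      ∑ i ∈ s, ∫ x, u x * (φ i x * weightedDiv (fun k => η i ⊛ g k) x) := by
    simp only [Finset.sum_mul]
    rw [integral_finsetSum _ fun i _ => hg.integrable_mul_weightedDiv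
      (integrable_mollify (η i) (huφ i))]
    refine Finset.sum_congr rfl fun i _ => ?_
    rw [integral_mollify_mul (η i) (huφ i) hwi]
    congr 1; ext x
    rw [mollify_weightedDiv (η i) hg, mul_assoc]
  have hright : ∫ x, u x * weightedDiv (fun k x => ∑ i ∈ s, φ i x * (η i ⊛ g k) x) x =
      (∑ i ∈ s, ∫ x, u x * (φ i x * weightedDiv (fun k => η i ⊛ g k) x)) +
      ∑ i ∈ s, ∑ j : Fin n, ∫ x, u x *
        (fderiv ℝ (φ i) x (EuclideanSpace.single j 1) * (η i ⊛ g j.castSucc) x) := by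
    have hpt : ∀ x, weightedDiv (fun k x => ∑ i ∈ s, φ i x * (η i ⊛ g k) x) x = _ :=
      weightedDiv_sum_mul s (fun i => (hφs i).differentiable (by simp))
        fun i k => (hGs i k).differentiable (by simp)
    simp only [hpt, mul_add, Finset.mul_sum]
    rw [integral_add (integrable_finsetSum _ fun i _ => iA i)
      (integrable_finsetSum _ fun i _ => integrable_finsetSum _ fun j _ => iB i j),
      integral_finsetSum _ fun i _ => iA i,
      integral_finsetSum _ fun i _ => integrable_finsetSum _ fun j _ => iB i j]
    congr 1
    exact Finset.sum_congr rfl fun i _ => integral_finsetSum _ fun j _ => iB i j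
  have hzero : ∑ i ∈ s, ∑ j : Fin n, ∫ x,
      u x * fderiv ℝ (φ i) x (EuclideanSpace.single j 1) * g j.castSucc x = 0 := by
    rw [Finset.sum_comm]
    refine Finset.sum_eq_zero fun j _ => ?_
    rw [← integral_finsetSum _ fun i _ => hmulg (hud i _) _]
    refine integral_eq_zero_of_ae (Eventually.of_forall fun x => ?_)
    simp only [Pi.zero_apply]
    rw [← Finset.sum_mul, ← Finset.mul_sum]
    by_cases hx : x ∈ L
    · have h1 : fderiv ℝ (fun y => ∑ i ∈ s, φ i y) x = 0 := by
        rw [Filter.EventuallyEq.fderiv_eq (f := fun _ => (1 : ℝ)) (hsum x hx)]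
        simp
      rw [fderiv_fun_sum fun i _ => (hφs i).differentiable (by simp) x] at h1
      have h2 := DFunLike.congr_fun h1 (EuclideanSpace.single j (1 : ℝ))
      simp only [FunLike.coe_sum, Finset.sum_apply] at h2
      rw [h2]; simp
    · rw [image_eq_zero_of_notMem_tsupport fun h => hx (hgL j.castSucc h), mul_zero]
  have herr : ∑ i ∈ s, ∑ j : Fin n, ∫ x,
        ((η i ⊛ fun y => u y * fderiv ℝ (φ i) y (EuclideanSpace.single j 1)) x -
          u x * fderiv ℝ (φ i) x (EuclideanSpace.single j 1)) * g j.castSucc x =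
      ∑ i ∈ s, ∑ j : Fin n, ∫ x, u x *
        (fderiv ℝ (φ i) x (EuclideanSpace.single j 1) * (η i ⊛ g j.castSucc) x) := by
    rw [← sub_zero (∑ i ∈ s, ∑ j : Fin n, ∫ x, u x * (_ * _)), ← hzero]
    simp only [← Finset.sum_sub_distrib]
    refine Finset.sum_congr rfl fun i _ => Finset.sum_congr rfl fun j _ => ?_
    simp only [sub_mul]
    rw [integral_sub (hmulg (integrable_mollify (η i) (hud i _)) _) (hmulg (hud i _) _),
      integral_mollify_mul (η i) (hud i _) (hgi _)]
    simp only [mul_assoc]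
  rw [hleft, hright, herr]
  ring

/-- A finite family of integrable functions is simultaneously well approximated by a mollification
of arbitrarily small radius. -/
theorem exists_bump_forall_integral_abs_mollify_sub_le {κ : Type*} [Finite κ] {f : κ → 𝔼 → ℝ}
    (hf : ∀ j, Integrable (f j)) {r ε : ℝ} (hr : 0 < r) (hε : 0 < ε) :
    ∃ η : ContDiffBump (0 : 𝔼), η.rOut < r ∧ ∀ j, ∫ x, |(η ⊛ f j) x - f j x| ≤ ε := by
  choose δ hδ H using fun j => integral_abs_mollify_sub_le (hf j) hε
  obtain ⟨ρ, ⟨hρ0, hρr⟩, hρ⟩ := ((eventually_mem_set.2 (Ioo_mem_nhdsGT hr)).and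
    (eventually_all.2 fun j => eventually_mem_set.2 (Ioo_mem_nhdsGT (hδ j)))).exists
  exact ⟨⟨ρ / 2, ρ, by positivity, by linarith⟩, hρr, fun j => H j _ (hρ j).2⟩

/-- Approximation by smooth functions in `L¹(Ω)` that increases `Ffun` by at most `ε`. -/
theorem exists_contDiffOn_Ffun_le {Ω : Set 𝔼} (hΩ : IsOpen Ω) {u : 𝔼 → ℝ} (hu : Integrable u)
    {ε : ℝ} (hε : 0 < ε) :
    ∃ w : 𝔼 → ℝ, ContDiffOn ℝ (⊤ : ℕ∞) w Ω ∧ IntegrableOn w Ω ∧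
      ∫ x in Ω, |w x - u x| ≤ ε ∧ Ffun n Ω w ≤ Ffun n Ω u + ENNReal.ofReal ε := by
  obtain ⟨φ, r, hφs, hφc, hφΩ, hφ0, hφ1, hr, hφL⟩ := exists_partition hΩ
  have huφ : ∀ i, Integrable fun x => u x * φ i x := fun i =>
    integrable_mul_of_hasCompactSupport hu (hφs i).continuous (hφc i)
  have hud : ∀ i e, Integrable fun x => u x * fderiv ℝ (φ i) x e := fun i e =>
    integrable_mul_of_hasCompactSupport hu
      (((hφs i).continuous_fderiv (by simp)).clm_apply continuous_const)
      ((hφc i).fderiv_apply ℝ e)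
  set c : ℝ := ε / (n + 1) with hc
  have hc0 : 0 < c := by positivity
  have hcε : c ≤ ε := div_le_self hε.le (by linarith [(Nat.cast_nonneg n : (0 : ℝ) ≤ n)])
  have hncε : n * c ≤ ε := by
    rw [hc, mul_div_assoc', div_le_iff₀ (by positivity)]
    nlinarith
  set b : ℕ → ℝ := fun i => c / 2 / 2 ^ i with hb
  have hb0 : ∀ i, 0 < b i := fun i => by positivity
  have hbs : HasSum b c := hasSum_geometric_two' c
  choose η hηr hη using fun i =>
    exists_bump_forall_integral_abs_mollify_sub_le (κ := Option (Fin n))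
      (f := fun o x => u x * o.elim (φ i x) fun j => fderiv ℝ (φ i) x (EuclideanSpace.single j 1))
      (fun o => match o with
        | none => huφ i
        | some j => hud i _) (hr i) (hb0 i)
  set F : ℕ → 𝔼 → ℝ := fun i => η i ⊛ fun y => u y * φ i y with hF
  have hFs : ∀ i, ContDiff ℝ (⊤ : ℕ∞) (F i) := fun i => contDiff_mollify (η i) (huφ i)
  have hFi : ∀ i, Integrable (F i) := fun i => integrable_mollify (η i) (huφ i)
  have hη0 : ∀ i, ∫ x, |F i x - u x * φ i x| ≤ b i := fun i => hη i none
  have hη1 : ∀ i (j : Fin n), ∫ x,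
      |(η i ⊛ fun y => u y * fderiv ℝ (φ i) y (EuclideanSpace.single j 1)) x -
        u x * fderiv ℝ (φ i) x (EuclideanSpace.single j 1)| ≤ b i := fun i j => hη i (some j)
  have hloc : ∀ L, IsCompact L → L ⊆ Ω → ∃ M,
      (∀ x ∈ L, ∀ᶠ y in 𝓝 x, ∑ i ∈ Finset.range M, φ i y = 1) ∧
      ∀ x ∈ L, ∑' i, F i x = ∑ i ∈ Finset.range M, F i x := by
    intro L hL hLΩ
    obtain ⟨N, hN⟩ := hφL L hL hLΩ
    refine ⟨N, (hN N le_rfl).1, fun x hx => tsum_eq_sum fun i hi => ?_⟩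
    refine mollify_eq_zero (η i) fun y hy => ?_
    rw [(hN i (by simpa using hi)).2 x hx y (hy.trans (hηr i)), mul_zero]
  have hws : ContDiffOn ℝ (⊤ : ℕ∞) (fun x => ∑' i, F i x) Ω := by
    intro x hx
    obtain ⟨L, hL, hxL, hLΩ⟩ := exists_compact_subset hΩ hx
    obtain ⟨M, -, hM⟩ := hloc L hL hLΩ
    refine ContDiffAt.contDiffWithinAt ?_
    refine (ContDiff.sum fun i _ => hFs i : ContDiff ℝ (⊤ : ℕ∞)
      fun x => ∑ i ∈ Finset.range M, F i x).contDiffAt.congr_of_eventuallyEq ?_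
    filter_upwards [mem_interior_iff_mem_nhds.1 hxL] with y hy using hM y hy
  have hpt : ∀ x ∈ Ω, ‖(∑' i, F i x) - u x‖ₑ ≤ ∑' i, ‖F i x - u x * φ i x‖ₑ := by
    intro x hx
    obtain ⟨M, h1, hM⟩ := hloc {x} isCompact_singleton (singleton_subset_iff.2 hx)
    have hux : u x = ∑ i ∈ Finset.range M, u x * φ i x := by
      rw [← Finset.mul_sum, (h1 x rfl).self_of_nhds, mul_one]
    calc ‖(∑' i, F i x) - u x‖ₑ = ‖∑ i ∈ Finset.range M, (F i x - u x * φ i x)‖ₑ := by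
          rw [hM x rfl, Finset.sum_sub_distrib, ← hux]
      _ ≤ ∑ i ∈ Finset.range M, ‖F i x - u x * φ i x‖ₑ := enorm_sum_le _ _
      _ ≤ _ := ENNReal.sum_le_tsum _
  have hle : ∫⁻ x in Ω, ‖(∑' i, F i x) - u x‖ₑ ≤ ENNReal.ofReal ε := by
    calc _ ≤ ∫⁻ x in Ω, ∑' i, ‖F i x - u x * φ i x‖ₑ :=
          setLIntegral_mono' hΩ.measurableSet hpt
      _ ≤ ∫⁻ x, ∑' i, ‖F i x - u x * φ i x‖ₑ := setLIntegral_le_lintegral _ _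
      _ = ∑' i, ∫⁻ x, ‖F i x - u x * φ i x‖ₑ :=
          lintegral_tsum fun i => ((hFi i).sub (huφ i)).aestronglyMeasurable.enorm
      _ ≤ ∑' i, ENNReal.ofReal (b i) := by
          refine ENNReal.tsum_le_tsum fun i => ?_
          exact (ofReal_integral_norm_eq_lintegral_enorm ((hFi i).sub (huφ i))).symm.trans_le
            (ENNReal.ofReal_le_ofReal (hη0 i))
      _ = ENNReal.ofReal c := by
          rw [← ENNReal.ofReal_tsum_of_nonneg (fun i => (hb0 i).le) hbs.summable, hbs.tsum_eq]
      _ ≤ _ := ENNReal.ofReal_le_ofReal hcε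
  have hwu : IntegrableOn (fun x => (∑' i, F i x) - u x) Ω :=
    ⟨(hws.continuousOn.aestronglyMeasurable hΩ.measurableSet).sub
      hu.integrableOn.aestronglyMeasurable, hle.trans_lt ENNReal.ofReal_lt_top⟩
  refine ⟨fun x => ∑' i, F i x, hws, ?_, ?_, iSup_le fun ⟨g, hg⟩ => ?_⟩
  · exact (hwu.add hu.integrableOn).congr (Eventually.of_forall fun x => by simp)
  · rw [← ENNReal.ofReal_le_ofReal_iff hε.le]
    exact (ofReal_integral_norm_eq_lintegral_enorm hwu).trans_le hle
  · obtain ⟨L, hL, hLΩ, hgL⟩ := hg.exists_compact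
    obtain ⟨M, h1, hM⟩ := hloc L hL hLΩ
    have hH := Admissible.sum_mul_mollify (Finset.range M) η hφs hφc hφΩ hφ0 (hφ1 M) hg
    have hset : ∀ {h : Fin (n + 1) → 𝔼 → ℝ}, Admissible n Ω h → ∀ f : 𝔼 → ℝ,
        ∫ x in Ω, f x * weightedDiv h x = ∫ x, f x * weightedDiv h x := fun hh f =>
      setIntegral_eq_integral_of_forall_compl_eq_zero fun x hx => by
        rw [weightedDiv_eq_zero hh.2.2.1 hx, mul_zero]
    have key : ∫ x in Ω, (∑' i, F i x) * weightedDiv g x ≤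
        (∫ x in Ω, u x * weightedDiv
          (fun k x => ∑ i ∈ Finset.range M, φ i x * (η i ⊛ g k) x) x) + ε := by
      have e1 : ∫ x, (∑' i, F i x) * weightedDiv g x =
          ∫ x, (∑ i ∈ Finset.range M, F i x) * weightedDiv g x := by
        congr 1; ext x
        by_cases hx : x ∈ L
        · rw [hM x hx]
        · rw [weightedDiv_eq_zero hgL hx, mul_zero, mul_zero]
      rw [hset hg, hset hH, e1, integral_sum_mollify_mul_weightedDiv (Finset.range M) η hφs hφc hg
        hgL h1 hu, sub_eq_add_neg, ← Finset.sum_neg_distrib]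
      refine add_le_add_right ?_ _
      calc _ ≤ ∑ i ∈ Finset.range M, ∑ j : Fin n, b i := by
            refine Finset.sum_le_sum fun i _ => ?_
            rw [← Finset.sum_neg_distrib]
            refine Finset.sum_le_sum fun j _ => (neg_le_abs _).trans ?_
            refine (abs_integral_le_integral_abs).trans (le_trans ?_ (hη1 i j))
            refine integral_mono_of_nonneg (Eventually.of_forall fun x => abs_nonneg _)
              ((integrable_mollify (η i) (hud i _)).sub (hud i _)).abs
              (Eventually.of_forall fun x => ?_)
            simp only [abs_mul]
            exact mul_le_of_le_one_right (abs_nonneg _) (hg.abs_le_one _ x)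
        _ = n * ∑ i ∈ Finset.range M, b i := by simp [Finset.mul_sum]
        _ ≤ n * c := by
            gcongr
            exact sum_le_hasSum _ (fun i _ => (hb0 i).le) hbs
        _ ≤ ε := hncε
    refine (ENNReal.ofReal_le_ofReal key).trans (ENNReal.ofReal_add_le.trans ?_)
    gcongr
    exact hH.ofReal_le_Ffun u

theorem Ffun_congr {Ω : Set 𝔼} (hΩ : MeasurableSet Ω) {v w : 𝔼 → ℝ} (h : EqOn v w Ω) :
    Ffun n Ω v = Ffun n Ω w := by
  unfold Ffun
  congr 1; ext g
  congr 1
  exact setIntegral_congr_fun hΩ fun x hx => by simp only [h hx]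

end MeyersSerrin

/-- if `v ∈ BV(Ω)` then there is a sequence of smooth functions
`v_k ∈ C^∞(Ω)` with `v_k → v` in `L¹(Ω)` and
`∫_Ω √(v_k² + |Dv_k|²) dx → F(v)`. -/
theorem stmt_8 (n : ℕ) (Ω : Set (EuclideanSpace ℝ (Fin n)))
    (hΩo : IsOpen Ω) (hΩb : Bornology.IsBounded Ω)
    (v : EuclideanSpace ℝ (Fin n) → ℝ)
    (hv : IntegrableOn v Ω) (hA : Afun n Ω v < ⊤) :
    ∃ vk : ℕ → EuclideanSpace ℝ (Fin n) → ℝ,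
      (∀ k, ContDiffOn ℝ (⊤ : ℕ∞) (vk k) Ω) ∧
      (∀ k, IntegrableOn (vk k) Ω) ∧
      Filter.Tendsto (fun k => ∫ x in Ω, |vk k x - v x|) Filter.atTop (nhds 0) ∧
      Filter.Tendsto
        (fun k => ∫⁻ x in Ω,
          ENNReal.ofReal (Real.sqrt (vk k x ^ 2 + ‖fderivWithin ℝ (vk k) Ω x‖ ^ 2)))
        Filter.atTop (nhds (Ffun n Ω v)) := by
  have heq : Set.EqOn (Ω.indicator v) v Ω := fun x hx => Set.indicator_of_mem hx v
  choose w hws hwi hwv hwF using fun k : ℕ => exists_contDiffOn_Ffun_le hΩo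
    (hv.integrable_indicator hΩo.measurableSet) (Nat.one_div_pos_of_nat (α := ℝ) (n := k))
  have hε := tendsto_one_div_add_atTop_nhds_zero_nat (𝕜 := ℝ)
  have hwv' : ∀ k, ∫ x in Ω, |w k x - v x| ≤ 1 / ((k : ℝ) + 1) := fun k => by
    refine (setIntegral_congr_fun hΩo.measurableSet fun x hx => ?_).trans_le (hwv k)
    simp only [heq hx]
  have hL1 : Filter.Tendsto (fun k => ∫ x in Ω, |w k x - v x|) Filter.atTop (nhds 0) :=
    squeeze_zero (fun k => integral_nonneg fun x => abs_nonneg _) hwv' hε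
  refine ⟨w, hws, hwi, hL1, tendsto_of_le_liminf_of_limsup_le ?_ ?_⟩
  · refine iSup_le fun ⟨g, hg⟩ => ?_
    have hlim : Filter.Tendsto (fun k => ∫ x in Ω, w k x * weightedDiv g x) Filter.atTop
        (nhds (∫ x in Ω, v x * weightedDiv g x)) := by
      obtain ⟨C, hC⟩ := hg.hasCompactSupport_weightedDiv.exists_bound_of_continuous
        hg.continuous_weightedDiv
      refine tendsto_iff_norm_sub_tendsto_zero.2 (squeeze_zero (fun k => norm_nonneg _)
        (fun k => ?_) (by simpa using hL1.mul_const C))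
      rw [← integral_sub (hg.integrable_mul_weightedDiv (hwi k))
        (hg.integrable_mul_weightedDiv hv), ← integral_mul_const]
      refine (norm_integral_le_integral_norm _).trans (integral_mono_of_nonneg
        (Filter.Eventually.of_forall fun x => norm_nonneg _)
        (((hwi k).sub hv).abs.mul_const C) (Filter.Eventually.of_forall fun x => ?_))
      simp only [← sub_mul, norm_mul]
      exact mul_le_mul_of_nonneg_left (hC x) (norm_nonneg _)
    refine ((ENNReal.tendsto_ofReal hlim).liminf_eq.symm.trans_le ?_)
    exact Filter.liminf_le_liminf (Filter.Eventually.of_forall fun k =>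
      ofReal_setIntegral_mul_weightedDiv_le hΩo ((hws k).of_le (by exact_mod_cast le_top)) hg)
  · have hlim : Filter.Tendsto (fun k : ℕ => Ffun n Ω v + ENNReal.ofReal (1 / ((k : ℝ) + 1)))
        Filter.atTop (nhds (Ffun n Ω v)) := by
      simpa using tendsto_const_nhds.add (ENNReal.tendsto_ofReal hε)
    refine le_trans (Filter.limsup_le_limsup (Filter.Eventually.of_forall fun k => ?_))
      hlim.limsup_eq.le
    rw [← Ffun_congr hΩo.measurableSet heq]
    exact (lintegral_le_Ffun hΩo (hws k)).trans (hwF k)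
end
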